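/- Let Q be a probability measure on a measurable space S and 1 < α ≤ 2. For all bounded measurable f, g : S → ℝ admitting deformed log-normalizers A_α(f), A_α(g), with p_f = exp_{2−α}(f − A_α(f)) and p_g = exp_{2−α}(g − A_α(g)): B_{Ω_α}(p_f, p_g) ≤ (1/(α−1))·‖p_f − p_g‖_∞·[(‖p_f‖_∞ + ‖p_f − p_g‖_∞)^{α−1} + exp_{2−α}(2·‖g‖_∞)]. -/

import Mathlib

open MeasureTheory

/-- The deformed exponential `exp_{2-α}(x) = [1 + (α-1)x]₊^{1/(α-1)}` for `1 < α ≤ 2`. -/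
noncomputable def dexp (α x : ℝ) : ℝ := (max (1 + (α - 1) * x) 0) ^ (1 / (α - 1))

/-- The `α`-Tsallis negative entropy `Ω_α(p) = (1/(α(α-1)))·(∫ p^α dQ − 1)`. -/
noncomputable def Tsallis {X : Type*} [MeasurableSpace X] (Q : Measure X) (α : ℝ)
    (p : X → ℝ) : ℝ :=
  (1 / (α * (α - 1))) * ((∫ t, p t ^ α ∂Q) - 1)

/-- The Bregman divergence of the `α`-Tsallis negative entropy, with gradient
`∇Ω_α(q)(t) = q(t)^{α-1}/(α-1)`. -/
noncomputable def BregTsallis {X : Type*} [MeasurableSpace X] (Q : Measure X) (α : ℝ)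
    (p q : X → ℝ) : ℝ :=
  Tsallis Q α p - Tsallis Q α q - ∫ t, (q t ^ (α - 1) / (α - 1)) * (p t - q t) ∂Q


lemma dexp_nonneg' (α x : ℝ) : 0 ≤ dexp α x := Real.rpow_nonneg (le_max_right _ _) _

lemma dexp_mono' {α x y : ℝ} (h : 1 < α) (hxy : x ≤ y) : dexp α x ≤ dexp α y := by
  unfold dexp
  apply Real.rpow_le_rpow (le_max_right _ _)
  · apply max_le_max _ le_rfl
    have := mul_le_mul_of_nonneg_left hxy (sub_pos.2 h).le
    linarith
  · exact (one_div_pos.2 (sub_pos.2 h)).le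

lemma dexp_pow' {α : ℝ} (x : ℝ) (h : 1 < α) :
    dexp α x ^ (α - 1) = max (1 + (α - 1) * x) 0 := by
  unfold dexp
  rw [← Real.rpow_mul (le_max_right _ _), one_div_mul_cancel (sub_pos.2 h).ne', Real.rpow_one]

lemma dexp_measurable' (α : ℝ) : Measurable (dexp α) := by
  unfold dexp
  fun_prop

lemma tangent' {α p q : ℝ} (h : 1 < α) (hp : 0 ≤ p) (hq : 0 ≤ q) :
    p ^ α - q ^ α ≤ α * (p ^ (α - 1) * (p - q)) := by
  rcases hp.eq_or_lt with rfl | hp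
  · rw [Real.zero_rpow (by linarith), Real.zero_rpow (by linarith)]
    have := Real.rpow_nonneg hq α
    linarith
  · have h1 := one_add_mul_self_le_rpow_one_add (s := q / p - 1)
      (by have := div_nonneg hq hp.le; linarith) h.le
    rw [show 1 + (q / p - 1) = q / p by ring, Real.div_rpow hq hp.le,
      le_div_iff₀ (Real.rpow_pos_of_pos hp _)] at h1
    have h2 : p ^ α = p ^ (α - 1) * p := by
      rw [Real.rpow_sub_one hp.ne']; field_simp
    have h3 : (1 + α * (q / p - 1)) * p ^ α = p ^ α - α * (p ^ (α - 1) * (p - q)) := by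
      rw [h2]; field_simp; ring
    linarith

lemma integrable_bdd' {S : Type*} [MeasurableSpace S] (Q : Measure S) [IsProbabilityMeasure Q]
    {u : S → ℝ} (hu : Measurable u) (C : ℝ) (hC : ∀ t, |u t| ≤ C) : Integrable u Q :=
  Integrable.of_bound hu.aestronglyMeasurable C (Filter.Eventually.of_forall hC)

/-- The second part of Lemma 5 of the paper (Appendix): for bounded measurable `f, g`
admitting deformed log-normalizers, with `p_f = exp_{2-α}(f - A_α(f))` and
`p_g = exp_{2-α}(g - A_α(g))`,
`B_{Ω_α}(p_f, p_g) ≤ (1/(α-1))‖p_f - p_g‖_∞·[(‖p_f‖_∞ + ‖p_f - p_g‖_∞)^{α-1}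
  + exp_{2-α}(2‖g‖_∞)]`. -/
theorem deformed_density_bregman_bound
    {S : Type*} [MeasurableSpace S] (Q : Measure S) [IsProbabilityMeasure Q]
    (α : ℝ) (hα1 : 1 < α) (hα2 : α ≤ 2)
    (f g : S → ℝ) (hfm : Measurable f) (hgm : Measurable g)
    (Bf Bg : ℝ) (hfb : ∀ t, |f t| ≤ Bf) (hgb : ∀ t, |g t| ≤ Bg)
    (Af Ag : ℝ)
    (hAf : (∫ t, dexp α (f t - Af) ∂Q) = 1)
    (hAg : (∫ t, dexp α (g t - Ag) ∂Q) = 1) :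
    BregTsallis Q α (fun t => dexp α (f t - Af)) (fun t => dexp α (g t - Ag)) ≤
      (1 / (α - 1)) * (⨆ t, |dexp α (f t - Af) - dexp α (g t - Ag)|) *
        (((⨆ t, |dexp α (f t - Af)|) + ⨆ t, |dexp α (f t - Af) - dexp α (g t - Ag)|) ^ (α - 1)
          + dexp α (2 * ⨆ t, |g t|)) := by
  have ha : 0 < α - 1 := sub_pos.2 hα1
  have hne : Nonempty S := by
    by_contra hcon
    rw [not_nonempty_iff] at hcon
    rw [Measure.eq_zero_of_isEmpty Q, integral_zero_measure] at hAf
    exact zero_ne_one hAf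
  set p : S → ℝ := fun t => dexp α (f t - Af) with hpdef
  set q : S → ℝ := fun t => dexp α (g t - Ag) with hqdef
  have hp0 : ∀ t, 0 ≤ p t := fun t => dexp_nonneg' _ _
  have hq0 : ∀ t, 0 ≤ q t := fun t => dexp_nonneg' _ _
  have hpm : Measurable p := (dexp_measurable' α).comp (hfm.sub_const _)
  have hqm : Measurable q := (dexp_measurable' α).comp (hgm.sub_const _)
  obtain ⟨P, hP⟩ : ∃ P, ∀ t, p t ≤ P :=
    ⟨dexp α (Bf - Af), fun t => dexp_mono' hα1 (by linarith [le_abs_self (f t), hfb t])⟩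
  obtain ⟨R, hR⟩ : ∃ R, ∀ t, q t ≤ R :=
    ⟨dexp α (Bg - Ag), fun t => dexp_mono' hα1 (by linarith [le_abs_self (g t), hgb t])⟩
  change BregTsallis Q α p q ≤ (1 / (α - 1)) * (⨆ t, |p t - q t|) *
    (((⨆ t, |p t|) + ⨆ t, |p t - q t|) ^ (α - 1) + dexp α (2 * ⨆ t, |g t|))
  have hPD : ∀ t, |p t - q t| ≤ P + R := fun t => by
    rw [abs_le]; constructor <;> linarith [hp0 t, hq0 t, hP t, hR t]
  have hD : ∀ t, |p t - q t| ≤ ⨆ t, |p t - q t| := fun t =>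
    le_ciSup (f := fun t => |p t - q t|) ⟨P + R, by rintro _ ⟨t, rfl⟩; exact hPD t⟩ t
  have hPs : ∀ t, |p t| ≤ ⨆ t, |p t| := fun t =>
    le_ciSup (f := fun t => |p t|)
      ⟨P, by rintro _ ⟨t, rfl⟩; exact (abs_of_nonneg (hp0 t)).le.trans (hP t)⟩ t
  have hG : ∀ t, |g t| ≤ ⨆ t, |g t| := fun t =>
    le_ciSup (f := fun t => |g t|) ⟨Bg, by rintro _ ⟨t, rfl⟩; exact hgb t⟩ t
  generalize (⨆ t, |p t - q t|) = D at *
  generalize (⨆ t, |p t|) = M at *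
  generalize (⨆ t, |g t|) = G at *
  obtain ⟨t0⟩ := hne
  have hD0 : 0 ≤ D := (abs_nonneg _).trans (hD t0)
  have hM0 : 0 ≤ M := (abs_nonneg _).trans (hPs t0)
  have hG0 : 0 ≤ G := (abs_nonneg _).trans (hG t0)
  have ip : Integrable (fun t => p t ^ α) Q :=
    integrable_bdd' Q (hpm.pow_const _) (P ^ α) fun t => by
      rw [abs_of_nonneg (Real.rpow_nonneg (hp0 t) _)]
      exact Real.rpow_le_rpow (hp0 t) (hP t) (by linarith)
  have iq : Integrable (fun t => q t ^ α) Q :=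
    integrable_bdd' Q (hqm.pow_const _) (R ^ α) fun t => by
      rw [abs_of_nonneg (Real.rpow_nonneg (hq0 t) _)]
      exact Real.rpow_le_rpow (hq0 t) (hR t) (by linarith)
  have iq' : Integrable q Q :=
    integrable_bdd' Q hqm R fun t => by
      rw [abs_of_nonneg (hq0 t)]; exact hR t
  have hqR : ∀ t, q t ^ (α - 1) ≤ R ^ (α - 1) := fun t =>
    Real.rpow_le_rpow (hq0 t) (hR t) ha.le
  have ic : Integrable (fun t => (q t ^ (α - 1) / (α - 1)) * (p t - q t)) Q :=
    integrable_bdd' Q (((hqm.pow_const _).div_const _).mul (hpm.sub hqm))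
      (R ^ (α - 1) / (α - 1) * D) fun t => by
      have h0 := Real.rpow_nonneg (hq0 t) (α - 1)
      rw [abs_mul, abs_of_nonneg (div_nonneg h0 ha.le)]
      have h1 := (div_le_div_iff_of_pos_right ha).2 (hqR t)
      exact mul_le_mul h1 (hD t) (abs_nonneg _) ((div_nonneg h0 ha.le).trans h1)
  -- lower bound on the normalizer
  have hAG : -G ≤ Ag := by
    by_contra hcon
    push Not at hcon
    have h1 : ∀ t, dexp α (-G - Ag) ≤ q t := fun t =>
      dexp_mono' hα1 (by linarith [neg_abs_le (g t), hG t])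
    have h2 : 1 < dexp α (-G - Ag) := by
      unfold dexp
      apply Real.one_lt_rpow _ (one_div_pos.2 ha)
      apply lt_max_of_lt_left
      have : 0 < (α - 1) * (-G - Ag) := mul_pos ha (by linarith)
      linarith
    have h3 := integral_mono (integrable_const (μ := Q) (dexp α (-G - Ag))) iq' h1
    simp only [integral_const, probReal_univ, one_smul] at h3
    linarith
  have hqE : ∀ t, q t ^ (α - 1) ≤ dexp α (2 * G) := fun t => by
    have hb : 0 ≤ (α - 1) * (2 * G) := by positivity
    have h1 : q t ^ (α - 1) ≤ 1 + (α - 1) * (2 * G) := by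
      rw [hqdef]
      simp only
      rw [dexp_pow' _ hα1]
      apply max_le _ (by linarith)
      have := mul_le_mul_of_nonneg_left
        (show g t - Ag ≤ 2 * G by linarith [le_abs_self (g t), hG t]) ha.le
      linarith
    refine h1.trans ?_
    unfold dexp
    rw [max_eq_left (by linarith)]
    apply Real.self_le_rpow_of_one_le (by linarith)
    rw [le_div_iff₀ ha]; linarith
  have key : ∀ t, 1 / (α * (α - 1)) * (p t ^ α - q t ^ α)
      - (q t ^ (α - 1) / (α - 1)) * (p t - q t)
      ≤ (1 / (α - 1)) * D * ((M + D) ^ (α - 1) + dexp α (2 * G)) := fun t => by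
    have h1 := tangent' hα1 (hp0 t) (hq0 t)
    have h2 : p t ^ (α - 1) ≤ (M + D) ^ (α - 1) :=
      Real.rpow_le_rpow (hp0 t) (by linarith [le_abs_self (p t), hPs t]) ha.le
    have h3 : p t ^ (α - 1) * (p t - q t) ≤ (M + D) ^ (α - 1) * D :=
      (mul_le_mul_of_nonneg_left ((le_abs_self _).trans (hD t))
        (Real.rpow_nonneg (hp0 t) _)).trans (mul_le_mul_of_nonneg_right h2 hD0)
    have h4 : q t ^ (α - 1) * (-(p t - q t)) ≤ dexp α (2 * G) * D :=
      (mul_le_mul_of_nonneg_left ((neg_le_abs _).trans (hD t))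
        (Real.rpow_nonneg (hq0 t) _)).trans (mul_le_mul_of_nonneg_right (hqE t) hD0)
    have hα0 : 0 < α := by linarith
    have h5 : (p t ^ α - q t ^ α) / α ≤ (M + D) ^ (α - 1) * D := by
      rw [div_le_iff₀ hα0]
      nlinarith
    have h6 := mul_le_mul_of_nonneg_left (add_le_add h5 h4) (one_div_pos.2 ha).le
    calc _ = 1 / (α - 1) * ((p t ^ α - q t ^ α) / α + q t ^ (α - 1) * (-(p t - q t))) := by
          field_simp
          ring
      _ ≤ _ := h6
      _ = _ := by ring
  have id' : Integrable (fun t => 1 / (α * (α - 1)) * (p t ^ α - q t ^ α)) Q :=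
    (ip.sub iq).const_mul _
  have ie : Integrable (fun t => 1 / (α * (α - 1)) * (p t ^ α - q t ^ α)
      - (q t ^ (α - 1) / (α - 1)) * (p t - q t)) Q := id'.sub ic
  have hB : BregTsallis Q α p q = ∫ t, (1 / (α * (α - 1)) * (p t ^ α - q t ^ α)
      - (q t ^ (α - 1) / (α - 1)) * (p t - q t)) ∂Q := by
    rw [integral_sub id' ic, integral_const_mul, integral_sub ip iq]
    unfold BregTsallis Tsallis
    ring
  rw [hB]
  have h3 := integral_mono ie
    (integrable_const (μ := Q) ((1 / (α - 1)) * D * ((M + D) ^ (α - 1) + dexp α (2 * G)))) key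
  simpa only [integral_const, probReal_univ, one_smul] using h3
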